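/- arXiv:1405.1373 — 6 statements merged into one kernel-verified Lean document; each statement's English description precedes it below -/
import Mathlib

section
/- Let p : ℝ → ℝ be a polynomial of degree at most 4, let x0 ∈ ℝ and h > 0, and set v0 = (1/h)∫_{x0−h}^{x0} p(x) dx, v1 = (1/h)∫_{x0}^{x0+h} p(x) dx, v2 = (1/h)∫_{x0+h}^{x0+2h} p(x) dx. Then the fifth-order compact upwind relation holds exactly: (3/10)p(x0) + (6/10)p(x0+h) + (1/10)p(x0+2h) = (1/30)v0 + (19/30)v1 + (10/30)v2. -/
open intervalIntegral

/-- The integral of a quartic polynomial in terms of its coefficients. -/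
theorem integral_eval_of_degree_le_four {p : Polynomial ℝ} (hp : p.degree ≤ 4) (a b : ℝ) :
    ∫ x in a..b, p.eval x = ∑ i ∈ Finset.range 5,
      p.coeff i * ((b ^ (i + 1) - a ^ (i + 1)) / (i + 1)) := by
  have hn : p.natDegree < 5 := Nat.lt_succ_of_le (Polynomial.natDegree_le_of_degree_le hp)
  simp only [Polynomial.eval_eq_sum_range' hn]
  rw [intervalIntegral.integral_finsetSum
    fun i _ => Continuous.intervalIntegrable (by fun_prop) a b]
  simp only [intervalIntegral.integral_const_mul, integral_pow]

/-- For a polynomial of degree at most 4, the fifth-order compact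
upwind relation of Pirozzoli relating interface values to cell averages over
uniform cells of width `h` holds exactly. -/
theorem stmt2 (p : Polynomial ℝ) (hp : p.degree ≤ 4) (x0 h : ℝ) (hh : 0 < h)
    (v0 v1 v2 : ℝ)
    (hv0 : v0 = (1/h) * ∫ x in (x0 - h)..x0, p.eval x)
    (hv1 : v1 = (1/h) * ∫ x in x0..(x0 + h), p.eval x)
    (hv2 : v2 = (1/h) * ∫ x in (x0 + h)..(x0 + 2*h), p.eval x) :
    (3/10) * p.eval x0 + (6/10) * p.eval (x0 + h) + (1/10) * p.eval (x0 + 2*h)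
      = (1/30) * v0 + (19/30) * v1 + (10/30) * v2 := by
  have hn : p.natDegree < 5 := Nat.lt_succ_of_le (Polynomial.natDegree_le_of_degree_le hp)
  subst hv0 hv1 hv2
  rw [integral_eval_of_degree_le_four hp, integral_eval_of_degree_le_four hp,
    integral_eval_of_degree_le_four hp]
  simp only [Polynomial.eval_eq_sum_range' hn,
    Finset.sum_range_succ, Finset.sum_range_zero]
  push_cast
  field_simp
  ring
end

section
/- There exists a constant C > 0 such that for every function u : ℝ → ℝ that is five times continuously differentiable, every x0 ∈ ℝ, every h > 0, and every K ≥ 0 with |u⁽⁵⁾(x)| ≤ K for all x ∈ [x0−h, x0+2h], the residual of the fifth-order compact upwind relation evaluated at the exact solution satisfies |(3/10)u(x0) + (6/10)u(x0+h) + (1/10)u(x0+2h) − [(1/30)v0 + (19/30)v1 + (10/30)v2]| ≤ C·K·h⁵, where v0 = (1/h)∫_{x0−h}^{x0} u, v1 = (1/h)∫_{x0}^{x0+h} u, v2 = (1/h)∫_{x0+h}^{x0+2h} u. -/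
open intervalIntegral

/-- A `C^5` function is approximated on `[a, b]` by a quartic polynomial in `x - a`, with
Lagrange-type remainder. -/
theorem exists_quartic_approx {u : ℝ → ℝ} (hu : ContDiff ℝ 5 u) {a b K : ℝ} (hab : a < b)
    (hK : ∀ x ∈ Set.Icc a b, |iteratedDeriv 5 u x| ≤ K) :
    ∃ c₀ c₁ c₂ c₃ c₄ : ℝ, ∀ x ∈ Set.Icc a b,
      |u x - (c₀ + c₁ * (x - a) + c₂ * (x - a) ^ 2 + c₃ * (x - a) ^ 3 + c₄ * (x - a) ^ 4)|
        ≤ K * (x - a) ^ 5 / 24 := by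
  let d (k : ℕ) : ℝ := iteratedDerivWithin k u (Set.Icc a b) a
  refine ⟨d 0, d 1, d 2 / 2, d 3 / 6, d 4 / 24, fun x hx => ?_⟩
  have hbound : ∀ y ∈ Set.Icc a b, ‖iteratedDerivWithin (4 + 1) u (Set.Icc a b) y‖ ≤ K := by
    intro y hy
    rw [iteratedDerivWithin_eq_iteratedDeriv (uniqueDiffOn_Icc hab) hu.contDiffAt hy,
      Real.norm_eq_abs]
    exact hK y hy
  have hu' : ContDiffOn ℝ ((4 : ℕ) + 1) u (Set.Icc a b) :=
    ContDiff.contDiffOn (by norm_num; exact hu)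
  have h := taylor_mean_remainder_bound hab.le hu' hx hbound
  rw [taylor_within_apply, Real.norm_eq_abs] at h
  norm_num [Finset.sum_range_succ, Nat.factorial] at h
  convert h using 2
  simp only [d, iteratedDerivWithin_zero, iteratedDerivWithin_one]
  ring

/-- The integral of a quartic polynomial in `x - a`. -/
theorem integral_quartic (a c₀ c₁ c₂ c₃ c₄ p q : ℝ) :
    ∫ x in p..q, (c₀ + c₁ * (x - a) + c₂ * (x - a) ^ 2 + c₃ * (x - a) ^ 3 + c₄ * (x - a) ^ 4) =
      (c₀ * (q - a) + c₁ * (q - a) ^ 2 / 2 + c₂ * (q - a) ^ 3 / 3 + c₃ * (q - a) ^ 4 / 4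
        + c₄ * (q - a) ^ 5 / 5)
      - (c₀ * (p - a) + c₁ * (p - a) ^ 2 / 2 + c₂ * (p - a) ^ 3 / 3 + c₃ * (p - a) ^ 4 / 4
        + c₄ * (p - a) ^ 5 / 5) := by
  refine integral_eq_sub_of_hasDerivAt (f := fun x => c₀ * (x - a) + c₁ * (x - a) ^ 2 / 2
    + c₂ * (x - a) ^ 3 / 3 + c₃ * (x - a) ^ 4 / 4 + c₄ * (x - a) ^ 5 / 5) (fun x _ => ?_)
    (Continuous.intervalIntegrable (by fun_prop) _ _)
  have hx : HasDerivAt (fun x : ℝ => x - a) 1 x := (hasDerivAt_id x).sub_const a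
  refine HasDerivAt.congr_deriv (((((hx.const_mul c₀).add (((hx.pow 2).const_mul c₁).div_const 2)).add
    (((hx.pow 3).const_mul c₂).div_const 3)).add (((hx.pow 4).const_mul c₃).div_const 4)).add
    (((hx.pow 5).const_mul c₄).div_const 5)) ?_
  norm_num
  ring

/-- A uniform bound on `f - g` over an interval of length `h` bounds the difference of the
averages of `f` and `g`. -/
theorem abs_average_sub_le {f g : ℝ → ℝ} (hf : Continuous f) (hg : Continuous g) {p q h M : ℝ}
    (hh : 0 < h) (hpq : q - p = h) (hM : ∀ x ∈ Set.Icc p q, |f x - g x| ≤ M) :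
    |1 / h * (∫ x in p..q, f x) - 1 / h * ∫ x in p..q, g x| ≤ M := by
  have hle : p ≤ q := by linarith
  have hI := norm_integral_le_of_norm_le_const (a := p) (b := q) (f := fun x => f x - g x)
    (C := M) fun x hx => by
      rw [Set.uIoc_of_le hle] at hx
      exact hM x ⟨hx.1.le, hx.2⟩
  rw [integral_sub (hf.intervalIntegrable _ _) (hg.intervalIntegrable _ _), hpq,
    abs_of_pos hh, Real.norm_eq_abs] at hI
  rw [← mul_sub, abs_mul, abs_of_pos (one_div_pos.mpr hh), one_div_mul_eq_div]
  exact (div_le_iff₀ hh).mpr hI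

/-- The truncation error of the fifth-order compact upwind relation
is `O(h^5)`: there is a constant `C > 0` such that for every `C^5` function `u`
whose fifth derivative is bounded by `K` on `[x0 - h, x0 + 2h]`, the residual of
the relation evaluated at the exact cell averages is at most `C * K * h^5`. -/
theorem stmt3 :
    ∃ C : ℝ, 0 < C ∧
      ∀ (u : ℝ → ℝ), ContDiff ℝ 5 u →
        ∀ (x0 h K : ℝ), 0 < h → 0 ≤ K →
          (∀ x ∈ Set.Icc (x0 - h) (x0 + 2*h), |iteratedDeriv 5 u x| ≤ K) →
          |(3/10) * u x0 + (6/10) * u (x0 + h) + (1/10) * u (x0 + 2*h)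
              - ((1/30) * ((1/h) * ∫ x in (x0 - h)..x0, u x)
                + (19/30) * ((1/h) * ∫ x in x0..(x0 + h), u x)
                + (10/30) * ((1/h) * ∫ x in (x0 + h)..(x0 + 2*h), u x))|
            ≤ C * K * h^5 := by
  refine ⟨25, by norm_num, fun u hu x0 h K hh hK hbd => ?_⟩
  obtain ⟨c₀, c₁, c₂, c₃, c₄, hc⟩ := exists_quartic_approx hu (by linarith) hbd
  let P : ℝ → ℝ := fun x => c₀ + c₁ * (x - (x0 - h)) + c₂ * (x - (x0 - h)) ^ 2
    + c₃ * (x - (x0 - h)) ^ 3 + c₄ * (x - (x0 - h)) ^ 4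
  have hP : Continuous P := by fun_prop
  have hM : ∀ x ∈ Set.Icc (x0 - h) (x0 + 2 * h), |u x - P x| ≤ K * (3 * h) ^ 5 / 24 := by
    intro x hx
    refine (hc x hx).trans ?_
    have h0 : 0 ≤ x - (x0 - h) := by linarith [hx.1]
    have h1 : x - (x0 - h) ≤ 3 * h := by linarith [hx.2]
    gcongr
  have e0 := abs_le.mp (hM x0 ⟨by linarith, by linarith⟩)
  have e1 := abs_le.mp (hM (x0 + h) ⟨by linarith, by linarith⟩)
  have e2 := abs_le.mp (hM (x0 + 2 * h) ⟨by linarith, by linarith⟩)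
  have i0 := abs_le.mp (abs_average_sub_le (p := x0 - h) (q := x0) hu.continuous hP hh (by ring)
    fun x hx => hM x ⟨by linarith [hx.1], by linarith [hx.2]⟩)
  have i1 := abs_le.mp (abs_average_sub_le (p := x0) (q := x0 + h) hu.continuous hP hh (by ring)
    fun x hx => hM x ⟨by linarith [hx.1], by linarith [hx.2]⟩)
  have i2 := abs_le.mp (abs_average_sub_le (p := x0 + h) (q := x0 + 2 * h) hu.continuous hP hh
    (by ring) fun x hx => hM x ⟨by linarith [hx.1], by linarith [hx.2]⟩)
  have exact_on_quartics : 3 / 10 * P x0 + 6 / 10 * P (x0 + h) + 1 / 10 * P (x0 + 2 * h)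
      = 1 / 30 * (1 / h * ∫ x in (x0 - h)..x0, P x)
        + 19 / 30 * (1 / h * ∫ x in x0..(x0 + h), P x)
        + 10 / 30 * (1 / h * ∫ x in (x0 + h)..(x0 + 2 * h), P x) := by
    simp only [P, integral_quartic]
    field_simp
    ring
  have hKh : 0 ≤ K * h ^ 5 := by positivity
  have hpow : K * (3 * h) ^ 5 / 24 = 81 / 8 * (K * h ^ 5) := by ring
  rw [hpow] at e0 e1 e2 i0 i1 i2
  rw [abs_le]
  constructor <;> linarith
end

section
/- Let p : ℝ → ℝ be a polynomial of degree at most 4, let a ∈ ℝ and h > 0, and set ū = (1/h)∫_a^{a+h} p(x) dx. Then there exists a point x* ∈ [a, a+h] such that p(x*) = (ū − (1/12)p(a) − (1/12)p(a+h)) / (5/6); that is, ū = (1/12)p(a) + (5/6)p(x*) + (1/12)p(a+h). -/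
open intervalIntegral

/-- The four-point Gauss–Lobatto quadrature rule is exact for polynomials of degree at most 5.
The interior nodes are `a + h / 2 * (1 ± s)` with `s ^ 2 = 1 / 5`. -/
theorem integral_eval_eq_gaussLobatto (p : Polynomial ℝ) (hp : p.natDegree < 6) (a h s : ℝ)
    (hs : s ^ 2 = 1 / 5) :
    ∫ x in a..(a + h), p.eval x = h * ((1 / 12) * p.eval a
      + (5 / 12) * p.eval (a + h / 2 * (1 - s)) + (5 / 12) * p.eval (a + h / 2 * (1 + s))
      + (1 / 12) * p.eval (a + h)) := by
  have hs4 : s ^ 4 = 1 / 25 := by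
    rw [show s ^ 4 = (s ^ 2) ^ 2 by ring, hs]
    norm_num
  have hint (c : ℝ) (n : ℕ) :
      IntervalIntegrable (fun x : ℝ ↦ c * x ^ n) MeasureTheory.volume a (a + h) :=
    (by fun_prop : Continuous fun x : ℝ ↦ c * x ^ n).intervalIntegrable _ _
  simp only [Polynomial.eval_eq_sum_range' hp]
  rw [integral_finsetSum fun n _ ↦ hint _ n]
  simp only [integral_const_mul, integral_pow, Finset.sum_range_succ, Finset.sum_range_zero]
  push_cast
  ring_nf
  rw [hs, hs4]
  ring

/-- For a polynomial `p` of degree at most 4 with cell average `ū`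
on `[a, a+h]`, there is a point `x* ∈ [a, a+h]` such that
`p(x*) = (ū − (1/12)p(a) − (1/12)p(a+h)) / (5/6)`, i.e.
`ū = (1/12)p(a) + (5/6)p(x*) + (1/12)p(a+h)`. -/
theorem stmt10 (p : Polynomial ℝ) (hp : p.degree ≤ 4) (a h : ℝ) (hh : 0 < h)
    (ubar : ℝ) (hubar : ubar = (1/h) * ∫ x in a..(a + h), p.eval x) :
    ∃ xstar ∈ Set.Icc a (a + h),
      p.eval xstar = (ubar - (1/12) * p.eval a - (1/12) * p.eval (a + h)) / (5/6)
      ∧ ubar = (1/12) * p.eval a + (5/6) * p.eval xstar + (1/12) * p.eval (a + h) := by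
  have hdeg : p.natDegree < 6 :=
    (Polynomial.natDegree_le_of_degree_le (n := 4) hp).trans_lt (by norm_num)
  obtain ⟨s, hs⟩ : ∃ s : ℝ, s ^ 2 = 1 / 5 := ⟨√(1 / 5), Real.sq_sqrt (by norm_num)⟩
  obtain ⟨hs₁, hs₂⟩ : -1 ≤ s ∧ s ≤ 1 := abs_le.mp ((sq_le_one_iff_abs_le_one s).mp (by norm_num [hs]))
  rw [integral_eval_eq_gaussLobatto p hdeg a h s hs, one_div, inv_mul_cancel_left₀ hh.ne'] at hubar
  have hx : a + h / 2 * (1 - s) ∈ Set.Icc a (a + h) := by constructor <;> nlinarith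
  have hy : a + h / 2 * (1 + s) ∈ Set.Icc a (a + h) := by constructor <;> nlinarith
  obtain ⟨z, hz, hpz⟩ : (p.eval (a + h / 2 * (1 - s)) + p.eval (a + h / 2 * (1 + s))) / 2 ∈
      (fun x ↦ p.eval x) '' Set.uIcc (a + h / 2 * (1 - s)) (a + h / 2 * (1 + s)) := by
    refine intermediate_value_uIcc p.continuous.continuousOn ?_
    rw [Set.mem_uIcc]
    rcases le_total (p.eval (a + h / 2 * (1 - s))) (p.eval (a + h / 2 * (1 + s))) with hle | hle
    · left; constructor <;> linarith
    · right; constructor <;> linarith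
  refine ⟨z, Set.uIcc_subset_Icc hx hy hz, ?_, ?_⟩ <;> linarith
end

section
/- Let m, M, ū, m_j, M_j be real numbers with m ≤ ū ≤ M and m_j < ū < M_j, and define the limiter coefficient θ = min{ (M − ū)/(M_j − ū), (ū − m)/(ū − m_j), 1 }. Then 0 ≤ θ ≤ 1, and for every v ∈ ℝ with m_j ≤ v ≤ M_j, the rescaled value θ(v − ū) + ū satisfies m ≤ θ(v − ū) + ū ≤ M. -/
/-- The Zhang–Shu limiter coefficient
`θ = min{(M − ū)/(M_j − ū), (ū − m)/(ū − m_j), 1}` lies in `[0, 1]`, and every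
rescaled value `θ(v − ū) + ū` with `v ∈ [m_j, M_j]` lies in `[m, M]`. -/
theorem stmt11 (m M ubar mj Mj : ℝ)
    (h1 : m ≤ ubar) (h2 : ubar ≤ M) (h3 : mj < ubar) (h4 : ubar < Mj)
    (θ : ℝ)
    (hθ : θ = min (min ((M - ubar) / (Mj - ubar)) ((ubar - m) / (ubar - mj))) 1) :
    (0 ≤ θ ∧ θ ≤ 1)
    ∧ ∀ v : ℝ, mj ≤ v → v ≤ Mj →
        m ≤ θ * (v - ubar) + ubar ∧ θ * (v - ubar) + ubar ≤ M := by
  have hMj : 0 < Mj - ubar := sub_pos.2 h4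
  have hmj : 0 < ubar - mj := sub_pos.2 h3
  have h_nonneg : 0 ≤ θ := by
    rw [hθ]
    exact le_min (le_min (div_nonneg (sub_nonneg.2 h2) hMj.le)
      (div_nonneg (sub_nonneg.2 h1) hmj.le)) zero_le_one
  have h_upper : θ * (Mj - ubar) ≤ M - ubar :=
    (le_div_iff₀ hMj).1 (hθ.le.trans ((min_le_left _ _).trans (min_le_left _ _)))
  have h_lower : θ * (ubar - mj) ≤ ubar - m :=
    (le_div_iff₀ hmj).1 (hθ.le.trans ((min_le_left _ _).trans (min_le_right _ _)))
  refine ⟨⟨h_nonneg, hθ.le.trans (min_le_right _ _)⟩, fun v hv_lower hv_upper => ⟨?_, ?_⟩⟩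
  · linarith [mul_le_mul_of_nonneg_left hv_lower h_nonneg]
  · linarith [mul_le_mul_of_nonneg_left hv_upper h_nonneg]
end

section
/- Let f : ℝ → ℝ and α > 0 satisfy |f(u) − f(v)| ≤ α|u − v| for all u, v ∈ ℝ, let h(u, v) = (1/2)(f(u) + f(v) − α(v − u)) be the Lax–Friedrichs flux, and let λ ≥ 0 satisfy the CFL condition λα ≤ 1/12. Let m ≤ M and let (ū_j)_{j∈ℤ}, (L_j)_{j∈ℤ}, (R_j)_{j∈ℤ}, (q_j)_{j∈ℤ} be sequences of real numbers such that for every j ∈ ℤ: (i) ū_j = (1/12)L_j + (5/6)q_j + (1/12)R_j, and (ii) m ≤ L_j ≤ M, m ≤ R_j ≤ M, m ≤ q_j ≤ M. Then the one-dimensional finite volume update ū'_j = ū_j − λ(h(R_j, L_{j+1}) − h(R_{j−1}, L_j)) satisfies m ≤ ū'_j ≤ M for all j ∈ ℤ. -/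
/-- If `f` is `α`-Lipschitz, then `x ↦ α x - f x` and `x ↦ α x + f x` are monotone. -/
lemma flux_splitting_monotone {f : ℝ → ℝ} {α : ℝ}
    (hf : ∀ u v : ℝ, |f u - f v| ≤ α * |u - v|) :
    Monotone (fun x => α * x - f x) ∧ Monotone (fun x => α * x + f x) := by
  have key : ∀ x y : ℝ, x ≤ y → -(α * (y - x)) ≤ f y - f x ∧ f y - f x ≤ α * (y - x) := by
    intro x y hxy
    have hyx := hf y x
    rw [abs_of_nonneg (sub_nonneg.2 hxy)] at hyx
    exact abs_le.1 hyx
  constructor <;> intro x y hxy <;> dsimp only <;> linarith [key x y hxy]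

/-- The three-point Lax–Friedrichs step preserves `[m, M]` under the CFL condition `μ α ≤ 1`. -/
lemma laxFriedrichs_step_mem_Icc {f : ℝ → ℝ} {α : ℝ}
    (hf : ∀ u v : ℝ, |f u - f v| ≤ α * |u - v|)
    {μ : ℝ} (hμ : 0 ≤ μ) (hcfl : μ * α ≤ 1) {m M a b c : ℝ}
    (ha : a ∈ Set.Icc m M) (hb : b ∈ Set.Icc m M) (hc : c ∈ Set.Icc m M) :
    b - μ * ((1/2) * (f b + f c - α * (c - b)) - (1/2) * (f a + f b - α * (b - a)))
      ∈ Set.Icc m M := by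
  obtain ⟨hsub, hadd⟩ := flux_splitting_monotone hf
  have hcoef : 0 ≤ 1 - μ * α := sub_nonneg.2 hcfl
  constructor
  · have h₁ := mul_le_mul_of_nonneg_left hb.1 hcoef
    have h₂ := mul_le_mul_of_nonneg_left (hsub hc.1) hμ
    have h₃ := mul_le_mul_of_nonneg_left (hadd ha.1) hμ
    dsimp only at h₂ h₃
    linarith
  · have h₁ := mul_le_mul_of_nonneg_left hb.2 hcoef
    have h₂ := mul_le_mul_of_nonneg_left (hsub hc.2) hμ
    have h₃ := mul_le_mul_of_nonneg_left (hadd ha.2) hμ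
    dsimp only at h₂ h₃
    linarith

/-- Strict maximum principle for the limited fifth-order finite
volume scheme with forward Euler time stepping: under the CFL condition
`λα ≤ 1/12`, if the cell averages decompose by the 4-point Gauss–Lobatto rule as
`ū_j = (1/12)L_j + (5/6)q_j + (1/12)R_j` with all values `L_j, R_j, q_j` in
`[m, M]`, then the updated cell averages stay in `[m, M]`. -/
theorem stmt13 (f : ℝ → ℝ) (α : ℝ) (hα : 0 < α)
    (hf : ∀ u v : ℝ, |f u - f v| ≤ α * |u - v|)
    (h : ℝ → ℝ → ℝ) (hdef : ∀ u v : ℝ, h u v = (1/2) * (f u + f v - α * (v - u)))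
    (lam : ℝ) (hlam : 0 ≤ lam) (hcfl : lam * α ≤ 1/12)
    (m M : ℝ) (hmM : m ≤ M)
    (ubar L R q : ℤ → ℝ)
    (hdecomp : ∀ j : ℤ, ubar j = (1/12) * L j + (5/6) * q j + (1/12) * R j)
    (hL : ∀ j : ℤ, m ≤ L j ∧ L j ≤ M)
    (hR : ∀ j : ℤ, m ≤ R j ∧ R j ≤ M)
    (hq : ∀ j : ℤ, m ≤ q j ∧ q j ≤ M)
    (ubar' : ℤ → ℝ)
    (hupd : ∀ j : ℤ, ubar' j
      = ubar j - lam * (h (R j) (L (j+1)) - h (R (j-1)) (L j))) :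
    ∀ j : ℤ, m ≤ ubar' j ∧ ubar' j ≤ M := by
  intro j
  have hμ : 0 ≤ 12 * lam := by positivity
  have hμα : 12 * lam * α ≤ 1 := by linarith
  have hright := laxFriedrichs_step_mem_Icc hf hμ hμα (hL j) (hR j) (hL (j + 1))
  have hleft := laxFriedrichs_step_mem_Icc hf hμ hμα (hR (j - 1)) (hL j) (hR j)
  have hqj := hq j
  rw [hupd, hdecomp, hdef, hdef]
  constructor
  · linarith [hright.1, hleft.1]
  · linarith [hright.2, hleft.2]
end

section
/- Let f, g : ℝ → ℝ with constants a1, a2 > 0 satisfy |f(u) − f(v)| ≤ a1|u − v| and |g(u) − g(v)| ≤ a2|u − v| for all u, v ∈ ℝ; let ĥf(u, v) = (1/2)(f(u) + f(v) − a1(v − u)) and ĥg(u, v) = (1/2)(g(u) + g(v) − a2(v − u)) be the Lax–Friedrichs fluxes. Let λ1, λ2 > 0 satisfy the CFL condition a1λ1 + a2λ2 ≤ 1/12, and set μ1 = a1λ1/(a1λ1 + a2λ2) and μ2 = a2λ2/(a1λ1 + a2λ2). Let L ≥ 1, let w_1, …, w_L ≥ 0 with w_1 + … + w_L = 1, let m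 ≤ M, and let real arrays ū_{ij}, Lx_{ijβ}, Rx_{ijβ}, By_{ijβ}, Ty_{ijβ}, qx_{ijβ}, qy_{ijβ} (indexed by (i, j) ∈ ℤ² and β ∈ {1, …, L}) satisfy for all i, j: (i) ū_{ij} = Σ_{β=1}^L w_β [ μ1((1/12)Lx_{ijβ} + (5/6)qx_{ijβ} + (1/12)Rx_{ijβ}) + μ2((1/12)By_{ijβ} + (5/6)qy_{ijβ} + (1/12)Ty_{ijβ}) ], and (ii) all the values Lx_{ijβ}, Rx_{ijβ}, By_{ijβ}, Ty_{ijβ}, qx_{ijβ}, qy_{ijβ} lie in [m, M]. Then the two-dimensional finite volume update ū'_{ij} = ū_{ij} − λ1 Σ_{β=1}^L w_β [ĥf(Rx_{ijβ}, Lx_{i+1,jβ}) − ĥf(Rx_{i−1,jβ}, Lx_{ijβ})] − λ2 Σ_{β=1}^L w_β [ĥg(Ty_{ijβ}, By_{i,j+1,β}) − ĥg(Ty_{i,j−1,β}, By_{ijβ})] satisfies m ≤ ū'_{ij} ≤ M for all (i, j) ∈ ℤ². -/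
/-- A Lipschitz function bounded against linear growth, scaled by a time step. -/
theorem abs_mul_sub_le_of_lipschitz {f : ℝ → ℝ} {a lam x y : ℝ} (hlam : 0 ≤ lam)
    (hf : ∀ u v : ℝ, |f u - f v| ≤ a * |u - v|) (hxy : x ≤ y) :
    lam * f y - lam * f x ≤ a * lam * y - a * lam * x ∧
      lam * f x - lam * f y ≤ a * lam * y - a * lam * x := by
  have h := hf y x
  rw [abs_of_nonneg (sub_nonneg.2 hxy), abs_le] at h
  constructor <;> nlinarith [mul_le_mul_of_nonneg_left h.1 hlam, mul_le_mul_of_nonneg_left h.2 hlam]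

/-- One-dimensional maximum principle for the Lax–Friedrichs flux, with the cell average
decomposed by the 4-point Gauss–Lobatto rule and scaled by `μ`. -/
theorem laxFriedrichs_gaussLobatto_mem_Icc {f : ℝ → ℝ} {a lam μ m M : ℝ} (hlam : 0 ≤ lam)
    (ha : 0 ≤ a) (hf : ∀ u v : ℝ, |f u - f v| ≤ a * |u - v|) {h : ℝ → ℝ → ℝ}
    (hdef : ∀ u v : ℝ, h u v = (1/2) * (f u + f v - a * (v - u)))
    (hμ : a * lam ≤ μ / 12) {l r q l' r' : ℝ} (hl : l ∈ Set.Icc m M) (hr : r ∈ Set.Icc m M)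
    (hq : q ∈ Set.Icc m M) (hl' : l' ∈ Set.Icc m M) (hr' : r' ∈ Set.Icc m M) :
    μ * ((1/12) * l + (5/6) * q + (1/12) * r) - lam * (h r l' - h r' l)
      ∈ Set.Icc (μ * m) (μ * M) := by
  have hμ0 : 0 ≤ μ := by linarith [mul_nonneg ha hlam]
  have scaled {x y : ℝ} (hxy : x ≤ y) : a * lam * y - a * lam * x ≤ μ / 12 * y - μ / 12 * x := by
    nlinarith
  have lip {x y : ℝ} (hxy : x ≤ y) := abs_mul_sub_le_of_lipschitz hlam hf hxy
  rw [hdef, hdef]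
  constructor
  · linarith [scaled hl.1, scaled hr.1, mul_le_mul_of_nonneg_left hq.1 hμ0,
      (lip hl.1).1, (lip hl.1).2, (lip hr.1).1, (lip hr.1).2,
      (lip hl'.1).1, (lip hl'.1).2, (lip hr'.1).1, (lip hr'.1).2]
  · linarith [scaled hl.2, scaled hr.2, mul_le_mul_of_nonneg_left hq.2 hμ0,
      (lip hl.2).1, (lip hl.2).2, (lip hr.2).1, (lip hr.2).2,
      (lip hl'.2).1, (lip hl'.2).2, (lip hr'.2).1, (lip hr'.2).2]

/-- Strict maximum principle for the limited two-dimensional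
finite volume scheme with forward Euler time stepping under the CFL condition
`a1λ1 + a2λ2 ≤ 1/12`: if the cell averages decompose by the `L`-point Gaussian
quadrature in the tangential directions and the 4-point Gauss–Lobatto rule in
the normal directions (with convex splitting parameters `μ1, μ2`), and all point
values lie in `[m, M]`, then the updated cell averages stay in `[m, M]`. -/
theorem stmt14 (f g : ℝ → ℝ) (a1 a2 : ℝ) (ha1 : 0 < a1) (ha2 : 0 < a2)
    (hf : ∀ u v : ℝ, |f u - f v| ≤ a1 * |u - v|)
    (hg : ∀ u v : ℝ, |g u - g v| ≤ a2 * |u - v|)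
    (hf' : ℝ → ℝ → ℝ) (hg' : ℝ → ℝ → ℝ)
    (hfdef : ∀ u v : ℝ, hf' u v = (1/2) * (f u + f v - a1 * (v - u)))
    (hgdef : ∀ u v : ℝ, hg' u v = (1/2) * (g u + g v - a2 * (v - u)))
    (lam1 lam2 : ℝ) (hlam1 : 0 < lam1) (hlam2 : 0 < lam2)
    (hcfl : a1 * lam1 + a2 * lam2 ≤ 1/12)
    (μ1 μ2 : ℝ)
    (hμ1 : μ1 = a1 * lam1 / (a1 * lam1 + a2 * lam2))
    (hμ2 : μ2 = a2 * lam2 / (a1 * lam1 + a2 * lam2))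
    (L : ℕ) (hL : 1 ≤ L)
    (w : Fin L → ℝ) (hw : ∀ β, 0 ≤ w β) (hwsum : ∑ β, w β = 1)
    (m M : ℝ) (hmM : m ≤ M)
    (ubar : ℤ → ℤ → ℝ)
    (Lx Rx By Ty qx qy : ℤ → ℤ → Fin L → ℝ)
    (hdecomp : ∀ i j : ℤ, ubar i j
      = ∑ β, w β * (μ1 * ((1/12) * Lx i j β + (5/6) * qx i j β + (1/12) * Rx i j β)
          + μ2 * ((1/12) * By i j β + (5/6) * qy i j β + (1/12) * Ty i j β)))
    (hbounds : ∀ i j : ℤ, ∀ β : Fin L,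
      Lx i j β ∈ Set.Icc m M ∧ Rx i j β ∈ Set.Icc m M
      ∧ By i j β ∈ Set.Icc m M ∧ Ty i j β ∈ Set.Icc m M
      ∧ qx i j β ∈ Set.Icc m M ∧ qy i j β ∈ Set.Icc m M)
    (ubar' : ℤ → ℤ → ℝ)
    (hupd : ∀ i j : ℤ, ubar' i j
      = ubar i j
        - lam1 * ∑ β, w β * (hf' (Rx i j β) (Lx (i+1) j β) - hf' (Rx (i-1) j β) (Lx i j β))
        - lam2 * ∑ β, w β * (hg' (Ty i j β) (By i (j+1) β) - hg' (Ty i (j-1) β) (By i j β))) :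
    ∀ i j : ℤ, m ≤ ubar' i j ∧ ubar' i j ≤ M := by
  have h1 : 0 < a1 * lam1 := mul_pos ha1 hlam1
  have h2 : 0 < a2 * lam2 := mul_pos ha2 hlam2
  have hS : 0 < a1 * lam1 + a2 * lam2 := add_pos h1 h2
  have hsum : μ1 + μ2 = 1 := by rw [hμ1, hμ2, ← add_div, div_self hS.ne']
  have hcfl1 : a1 * lam1 ≤ μ1 / 12 := by
    rw [hμ1, div_div, le_div_iff₀ (by positivity)]
    nlinarith
  have hcfl2 : a2 * lam2 ≤ μ2 / 12 := by
    rw [hμ2, div_div, le_div_iff₀ (by positivity)]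
    nlinarith
  intro i j
  have hconv : ubar' i j = ∑ β, w β • (
      (μ1 * ((1/12) * Lx i j β + (5/6) * qx i j β + (1/12) * Rx i j β)
        - lam1 * (hf' (Rx i j β) (Lx (i+1) j β) - hf' (Rx (i-1) j β) (Lx i j β)))
      + (μ2 * ((1/12) * By i j β + (5/6) * qy i j β + (1/12) * Ty i j β)
        - lam2 * (hg' (Ty i j β) (By i (j+1) β) - hg' (Ty i (j-1) β) (By i j β)))) := by
    rw [hupd, hdecomp, Finset.mul_sum, Finset.mul_sum, ← Finset.sum_sub_distrib,
      ← Finset.sum_sub_distrib]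
    refine Finset.sum_congr rfl fun β _ => ?_
    rw [smul_eq_mul]
    ring
  rw [hconv, ← Set.mem_Icc]
  refine (convex_Icc m M).sum_mem (fun β _ => hw β) hwsum fun β _ => ?_
  obtain ⟨hL, hR, hB, hT, hqx, hqy⟩ := hbounds i j β
  have hx := laxFriedrichs_gaussLobatto_mem_Icc hlam1.le ha1.le hf hfdef hcfl1 hL hR hqx
    (hbounds (i+1) j β).1 (hbounds (i-1) j β).2.1
  have hy := laxFriedrichs_gaussLobatto_mem_Icc hlam2.le ha2.le hg hgdef hcfl2 hB hT hqy
    (hbounds i (j+1) β).2.2.1 (hbounds i (j-1) β).2.2.2.1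
  have hm : μ1 * m + μ2 * m = m := by rw [← add_mul, hsum, one_mul]
  have hM : μ1 * M + μ2 * M = M := by rw [← add_mul, hsum, one_mul]
  exact ⟨hm ▸ add_le_add hx.1 hy.1, (add_le_add hx.2 hy.2).trans_eq hM⟩
end
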